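/- (Theorem 2.) Under the Weight Maximization with direct gradient update: the output-layer update satisfies ΔW^L = 2 · R(X,A) · A · (1 − π_{W^L}(H^{L−1},A)) · (H^{L−1})ᵀ, and for every l ∈ {1,…,L−1} the hidden-layer update satisfies ΔW^l = 2·4^{L−l} · R(X,A) · A · (1 − π_{W^L}(H^{L−1},A)) · (H^{l−1})ᵀ ((I ⊙ 𝟙σ'(H^{l−1}W^l)) (W^{l+1} ⊙ 𝟙σ'(H^l W^{l+1})) ⋯ (W^{L−1} ⊙ 𝟙σ'(H^{L−2}W^{L−1})) W^L)ᵀ, where π_{W^L}(h,a) = σ(a·hW^L), σ'(z) = σ(z)(1−σ(z)), and (W^k ⊙ 𝟙σ'(H^{k−1}W^k))_{ij} = W^k_{ij} σ'((H^{k−1}W^k)_j); these are, up to the stated positive constants, exactly the straight-through-estimator backpropagation updates (obtained from the chain rule by replacing the derivative of each threshold function by 1). -/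

import Mathlib

/-- The logistic sigmoid `σ(z) = 1/(1+exp(−z))`. -/
noncomputable def sig (z : ℝ) : ℝ := 1 / (1 + Real.exp (-z))

/-- `σ'(z) = σ(z)(1−σ(z))`. -/
noncomputable def sigp (z : ℝ) : ℝ := sig z * (1 - sig z)

/-- The values of all layers of a multi-layer network with `L = n+1` layers (besides the
input layer): layer `0` is the state `x`, and layer `t+1` is the hidden/output value
`g t ∈ {−1,+1}^{m (t+1)}`. -/
def Vof (n : ℕ) (m : ℕ → ℕ) (x : Fin (m 0) → ℝ)
    (g : (t : Fin (n + 1)) → Fin (m (t.1 + 1)) → ℝ) : (l : ℕ) → Fin (m l) → ℝ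
  | 0 => x
  | (t + 1) => if ht : t < n + 1 then g ⟨t, ht⟩ else fun _ => 1

/-- All assignments of values in `{−1,+1}` to the units of layers `1, …, n+1`. -/
noncomputable def hiddenSet (n : ℕ) (m : ℕ → ℕ) :
    Finset ((t : Fin (n + 1)) → Fin (m (t.1 + 1)) → ℝ) :=
  Fintype.piFinset fun _ => Fintype.piFinset fun _ => ({-1, 1} : Finset ℝ)

/-- Probability `∏_{l=1}^{L} π_l(H^{l−1}, H^l; W^l)` of the layer values `g` given the
state `x`, where `π_l(h^{l−1},h^l;W^l) = ∏_i σ(h^l_i · (h^{l−1}W^l)_i)`. -/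
noncomputable def Pg (n : ℕ) (m : ℕ → ℕ)
    (W : (t : ℕ) → Matrix (Fin (m t)) (Fin (m (t + 1))) ℝ)
    (x : Fin (m 0) → ℝ) (g : (t : Fin (n + 1)) → Fin (m (t.1 + 1)) → ℝ) : ℝ :=
  ∏ t : Fin (n + 1), ∏ i,
    sig (Vof n m x g (t.1 + 1) i * ∑ j, Vof n m x g t.1 j * W t.1 j i)

/-- The expected reward `J(W) = E[R(X,A) | π_W]` of the multi-layer network. -/
noncomputable def Jnet (n : ℕ) (m : ℕ → ℕ)
    (W : (t : ℕ) → Matrix (Fin (m t)) (Fin (m (t + 1))) ℝ)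
    (X : Finset (Fin (m 0) → ℝ)) (d0 : (Fin (m 0) → ℝ) → ℝ)
    (R : (Fin (m 0) → ℝ) → (Fin (m (n + 1)) → ℝ) → ℝ) : ℝ :=
  ∑ x ∈ X, ∑ g ∈ hiddenSet n m, d0 x * Pg n m W x g * R x (Vof n m x g (n + 1))

/-- The matrix `W^t` with its `(i,j)` entry replaced by `s`. -/
def updEntry {a b : Type*} [DecidableEq a] [DecidableEq b]
    (M : Matrix a b ℝ) (i : a) (j : b) (s : ℝ) : Matrix a b ℝ :=
  Matrix.of fun p q => if p = i ∧ q = j then s else M p q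

/-- The Weight Maximization with direct gradient update for the transition `t` (from
layer `t` into layer `t+1`), for the realization `V` of all layer values and reward `r`:
`ΔW^L = (H^{L−1})ᵀ R (A − E[A|H^{L−1}])`, and for hidden transitions
`ΔW^l = (H^{l−1})ᵀ (2 R^l ⊙ H^l ⊙ σ'(H^{l−1}W^l))` with
`R^l = (2(ΔW^{l+1} ⊙ W^{l+1})𝟙)ᵀ`. Here the output transition is `t = n` (so `L = n+1`). -/
noncomputable def dWdg (n : ℕ) (m : ℕ → ℕ)
    (W : (t : ℕ) → Matrix (Fin (m t)) (Fin (m (t + 1))) ℝ)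
    (V : (l : ℕ) → Fin (m l) → ℝ) (r : ℝ) (t : ℕ) :
    Matrix (Fin (m t)) (Fin (m (t + 1))) ℝ :=
  if t = n then
    Matrix.of fun i j =>
      V t i * (r * (V (t + 1) j - (2 * sig (∑ k, V t k * W t k j) - 1)))
  else if ht : t < n then
    Matrix.of fun i j =>
      V t i * (2 * (2 * ∑ k, dWdg n m W V r (t + 1) j k * W (t + 1) j k) *
        V (t + 1) j * sigp (∑ k, V t k * W t k j))
  else 0
termination_by n - t
decreasing_by omega

/-- The matrix product `(I ⊙ 𝟙σ'(H^{l−1}W^l)) (W^{l+1} ⊙ 𝟙σ'(H^l W^{l+1})) ⋯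
(W^{l+k} ⊙ 𝟙σ'(H^{l+k−1}W^{l+k}))` with `l = t+1`, where the first factor is diagonal
with entries `σ'((H^{l−1}W^l)_j)` and `(W^s ⊙ 𝟙σ'(H^{s−1}W^s))_{ij} = W^s_{ij}
σ'((H^{s−1}W^s)_j)`. -/
noncomputable def chainD (n : ℕ) (m : ℕ → ℕ)
    (W : (t : ℕ) → Matrix (Fin (m t)) (Fin (m (t + 1))) ℝ)
    (V : (l : ℕ) → Fin (m l) → ℝ) (t : ℕ) :
    (k : ℕ) → Matrix (Fin (m (t + 1))) (Fin (m (t + 1 + k))) ℝ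
  | 0 => Matrix.of fun i j =>
      if i = j then sigp (∑ p, V t p * W t p i) else 0
  | (k + 1) => chainD n m W V t k *
      Matrix.of (fun i j => W (t + 1 + k) i j * sigp (∑ p, V (t + 1 + k) p * W (t + 1 + k) p j))

theorem sig_neg_aux (z : ℝ) : sig (-z) = 1 - sig z := by
  unfold sig
  have h1 := Real.exp_pos z
  have h2 := Real.exp_pos (-z)
  have h3 : Real.exp z * Real.exp (-z) = 1 := by rw [← Real.exp_add]; simp
  rw [neg_neg]
  field_simp
  linarith

theorem out_aux (v z : ℝ) (hv : v = 1 ∨ v = -1) :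
    v - (2 * sig z - 1) = 2 * v * (1 - sig (v * z)) := by
  rcases hv with rfl | rfl
  · rw [one_mul]; ring
  · rw [neg_one_mul, sig_neg_aux]; ring

/-- The signal `H^l ⊙ (ΔW^{l+1} ⊙ W^{l+1})𝟙` arriving at layer `l`. -/
noncomputable def Usig (n : ℕ) (m : ℕ → ℕ)
    (W : (t : ℕ) → Matrix (Fin (m t)) (Fin (m (t + 1))) ℝ)
    (V : (l : ℕ) → Fin (m l) → ℝ) (r : ℝ) (l : ℕ) (i : Fin (m l)) : ℝ :=
  V l i * ∑ k, dWdg n m W V r l i k * W l i k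

theorem dWdg_hidden (n : ℕ) (m : ℕ → ℕ)
    (W : (t : ℕ) → Matrix (Fin (m t)) (Fin (m (t + 1))) ℝ)
    (V : (l : ℕ) → Fin (m l) → ℝ) (r : ℝ) (t : ℕ) (ht : t < n)
    (i : Fin (m t)) (j : Fin (m (t + 1))) :
    dWdg n m W V r t i j
      = 4 * V t i * (sigp (∑ k, V t k * W t k j) * Usig n m W V r (t + 1) j) := by
  rw [dWdg, if_neg ht.ne, dif_pos ht, Usig, Matrix.of_apply]
  ring

theorem dWdg_out (n : ℕ) (m : ℕ → ℕ)
    (W : (t : ℕ) → Matrix (Fin (m t)) (Fin (m (t + 1))) ℝ)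
    (V : (l : ℕ) → Fin (m l) → ℝ)
    (hV : ∀ l, 1 ≤ l → l ≤ n + 1 → ∀ i, V l i = 1 ∨ V l i = -1)
    (r : ℝ) (i : Fin (m n)) (j : Fin (m (n + 1))) :
    dWdg n m W V r n i j
      = 2 * r * V (n + 1) j * (1 - sig (V (n + 1) j * ∑ p, V n p * W n p j)) * V n i := by
  rw [dWdg, if_pos rfl, Matrix.of_apply,
    out_aux _ _ (hV (n + 1) (by omega) le_rfl j)]
  ring

theorem sq_aux (v : ℝ) (hv : v = 1 ∨ v = -1) : v * v = 1 := by
  rcases hv with rfl | rfl <;> norm_num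

theorem Usig_step (n : ℕ) (m : ℕ → ℕ)
    (W : (t : ℕ) → Matrix (Fin (m t)) (Fin (m (t + 1))) ℝ)
    (V : (l : ℕ) → Fin (m l) → ℝ)
    (hV : ∀ l, 1 ≤ l → l ≤ n + 1 → ∀ i, V l i = 1 ∨ V l i = -1)
    (r : ℝ) (l : ℕ) (hl : 1 ≤ l) (hn : l < n) (i : Fin (m l)) :
    Usig n m W V r l i
      = 4 * ∑ k, W l i k * sigp (∑ p, V l p * W l p k) * Usig n m W V r (l + 1) k := by
  have h := sq_aux _ (hV l hl (by omega) i)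
  rw [Usig, Finset.mul_sum, Finset.mul_sum]
  refine Finset.sum_congr rfl fun k _ => ?_
  rw [dWdg_hidden n m W V r l hn i k]
  linear_combination (4 * (sigp (∑ p, V l p * W l p k) * Usig n m W V r (l + 1) k) * W l i k) * h

theorem Usig_last (n : ℕ) (m : ℕ → ℕ) (hmL : m (n + 1) = 1)
    (W : (t : ℕ) → Matrix (Fin (m t)) (Fin (m (t + 1))) ℝ)
    (V : (l : ℕ) → Fin (m l) → ℝ)
    (hV : ∀ l, 1 ≤ l → l ≤ n + 1 → ∀ i, V l i = 1 ∨ V l i = -1)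
    (r : ℝ) (l : ℕ) (hl : 1 ≤ l) (hn : l = n) (i : Fin (m l)) (a : Fin (m (n + 1))) :
    Usig n m W V r l i
      = 2 * r * V (n + 1) a * (1 - sig (V (n + 1) a * ∑ p, V n p * W n p a)) *
        ∑ b : Fin (m (n + 1)), W n (Fin.cast (congrArg m hn) i) b := by
  subst hn
  have h := sq_aux _ (hV l hl (by omega) i)
  have hs : Subsingleton (Fin (m (l + 1))) := by rw [hmL]; infer_instance
  rw [Usig, Finset.mul_sum, Finset.mul_sum]
  refine Finset.sum_congr rfl fun k _ => ?_
  rw [dWdg_out l m W V hV r i k, Subsingleton.elim k a, Fin.cast_eq_self]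
  linear_combination (2 * r * V (l + 1) a *
    (1 - sig (V (l + 1) a * ∑ p, V l p * W l p a)) * W l i a) * h

theorem chainD_Usig (n : ℕ) (m : ℕ → ℕ)
    (W : (t : ℕ) → Matrix (Fin (m t)) (Fin (m (t + 1))) ℝ)
    (V : (l : ℕ) → Fin (m l) → ℝ)
    (hV : ∀ l, 1 ≤ l → l ≤ n + 1 → ∀ i, V l i = 1 ∨ V l i = -1)
    (r : ℝ) (t : ℕ) (j : Fin (m (t + 1))) (k : ℕ) (hk : t + 1 + k ≤ n) :
    sigp (∑ p, V t p * W t p j) * Usig n m W V r (t + 1) j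
      = 4 ^ k * ∑ c, chainD n m W V t k j c * Usig n m W V r (t + 1 + k) c := by
  induction k with
  | zero => simp [chainD]
  | succ k ih =>
    rw [ih (by omega), pow_succ, mul_assoc]
    congr 1
    simp only [chainD, Matrix.mul_apply, Matrix.of_apply, Finset.sum_mul]
    rw [Finset.sum_comm, Finset.mul_sum]
    refine Finset.sum_congr rfl fun d _ => ?_
    rw [Usig_step n m W V hV r (t + 1 + k) (by omega) (by omega) d, Finset.mul_sum,
      Finset.mul_sum, Finset.mul_sum]
    refine Finset.sum_congr rfl fun c _ => ?_
    change _ = 4 * (_ * Usig n m W V r (t + 1 + k + 1) c)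
    ring

/-- Theorem 2: the Weight Maximization with direct gradient update coincides (exactly,
with the stated positive constants) with the straight-through-estimator backpropagation
updates: for the output layer `ΔW^L = 2 R A (1 − π_{W^L}(H^{L−1},A)) (H^{L−1})ᵀ`, and for
every hidden transition `t < n` (layer `l = t+1 ∈ {1,…,L−1}`, `L = n+1`)
`ΔW^l = 2·4^{L−l} R A (1 − π_{W^L}(H^{L−1},A)) (H^{l−1})ᵀ
((I ⊙ 𝟙σ'(H^{l−1}W^l))(W^{l+1} ⊙ 𝟙σ'(H^l W^{l+1})) ⋯ (W^{L−1} ⊙ 𝟙σ'(H^{L−2}W^{L−1})) W^L)ᵀ`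
(entrywise; `A = V (n+1) a` is the action, and the sums over `c, b` range over
one-element index sets since `m^L = 1`). -/
theorem stmt12 (n : ℕ) (m : ℕ → ℕ) (hmL : m (n + 1) = 1)
    (W : (t : ℕ) → Matrix (Fin (m t)) (Fin (m (t + 1))) ℝ)
    (V : (l : ℕ) → Fin (m l) → ℝ)
    (hV : ∀ l, 1 ≤ l → l ≤ n + 1 → ∀ i, V l i = 1 ∨ V l i = -1)
    (r : ℝ) :
    (∀ (i : Fin (m n)) (j : Fin (m (n + 1))),
      dWdg n m W V r n i j
        = 2 * r * V (n + 1) j * (1 - sig (V (n + 1) j * ∑ p, V n p * W n p j)) * V n i) ∧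
    (∀ (t : ℕ) (ht : t < n) (i : Fin (m t)) (j : Fin (m (t + 1))) (a : Fin (m (n + 1))),
      dWdg n m W V r t i j
        = 2 * 4 ^ (n - t) * r * V (n + 1) a *
            (1 - sig (V (n + 1) a * ∑ p, V n p * W n p a)) *
            (V t i * ∑ c : Fin (m (t + 1 + (n - 1 - t))), ∑ b : Fin (m (n + 1)),
              chainD n m W V t (n - 1 - t) j c *
                W n (Fin.cast (congrArg m (by omega : t + 1 + (n - 1 - t) = n)) c) b)) := by
  refine ⟨dWdg_out n m W V hV r, ?_⟩
  intro t ht i j a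
  rw [dWdg_hidden n m W V r t ht i j,
    chainD_Usig n m W V hV r t j (n - 1 - t) (by omega),
    show n - t = (n - 1 - t) + 1 by omega, pow_succ]
  simp only [Usig_last n m hmL W V hV r (t + 1 + (n - 1 - t)) (by omega) (by omega) _ a,
    Finset.mul_sum]
  refine Finset.sum_congr rfl fun c _ => Finset.sum_congr rfl fun b _ => ?_
  ring
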